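/- Let K = ℚ(√D) with D ≥ 2 squarefree, with continued fraction expansion ω_D = [⌈u_0/2⌉, \overline{u_1, ..., u_s}] (u_s = u_0). There exists a totally positive α ∈ O_K with exactly 6 partitions, i.e. 6 ∈ p_K(O_K^+), if and only if at least one of the following holds: (i) u_i ≥ 8 for some odd i ≥ 1; (ii) u_i = 2 for some i ≥ 0; (iii) u_i ≥ 2 and u_{i+1} ≥ 2 for some i ≥ 0. -/

import Mathlib

noncomputable section

/-- `ω_D`: the standard generator of the ring of integers of `ℚ(√D)`. -/
def omegaD (D : ℕ) : ℝ := if D % 4 = 1 then (1 + Real.sqrt D) / 2 else Real.sqrt D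

/-- The Galois conjugate of `ω_D`. -/
def omegaD' (D : ℕ) : ℝ := if D % 4 = 1 then (1 - Real.sqrt D) / 2 else -Real.sqrt D

/-- Elements of `O_K` in coordinates: `(x, y)` represents `x + y·ω_D`. -/
abbrev OK : Type := ℤ × ℤ

/-- First real embedding. -/
def emb1 (D : ℕ) (a : OK) : ℝ := a.1 + a.2 * omegaD D

/-- Second real embedding (Galois conjugate). -/
def emb2 (D : ℕ) (a : OK) : ℝ := a.1 + a.2 * omegaD' D

/-- Galois conjugation on `O_K`. -/
def conjOK (D : ℕ) (a : OK) : OK := (a.1 + (if D % 4 = 1 then (1 : ℤ) else 0) * a.2, -a.2)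

/-- Total positivity. -/
def TotPos (D : ℕ) (a : OK) : Prop := 0 < emb1 D a ∧ 0 < emb2 D a

/-- The field norm. -/
def Nm (D : ℕ) (a : OK) : ℝ := emb1 D a * emb2 D a

/-- Indecomposability: totally positive and not a sum of two totally positive elements. -/
def Indec (D : ℕ) (a : OK) : Prop :=
  TotPos D a ∧ ¬ ∃ b c : OK, TotPos D b ∧ TotPos D c ∧ a = b + c

/-- Number of partitions of `α` into indecomposable parts (`p_K(α|I)`). -/
def pKI (D : ℕ) (α : OK) : ℕ :=
  Set.ncard {s : Multiset OK | (∀ x ∈ s, Indec D x) ∧ s.sum = α}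

/-- Number of partitions of `α` into totally positive parts (`p_K(α)`). -/
def pK (D : ℕ) (α : OK) : ℕ :=
  Set.ncard {s : Multiset OK | (∀ x ∈ s, TotPos D x) ∧ s.sum = α}

/-- Discriminant of `ℚ(√D)`. -/
def disc (D : ℕ) : ℕ := if D % 4 = 1 then D else 4 * D

/-- The ordered two-sided sequence of indecomposables together with
the coefficients `v j ≥ 2` from the Hejda–Kala relation `v_j β_j = β_{j-1} + β_{j+1}`. -/
structure BetaSeq (D : ℕ) (β : ℤ → OK) (v : ℤ → ℤ) : Prop where
  indec : ∀ j, Indec D (β j)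
  surj : ∀ a : OK, Indec D a → ∃ j, β j = a
  mono : StrictMono fun j => emb1 D (β j)
  zero : β 0 = (1, 0)
  conj_eq : ∀ j, β (-j) = conjOK D (β j)
  v_two_le : ∀ j, 2 ≤ v j
  v_symm : ∀ j, v (-j) = v j
  rel : ∀ j, v j • β j = β (j - 1) + β (j + 1)

/-- The continued fraction data of `ω_D = [⌈u₀/2⌉, \overline{u₁, …, u_s}]` (with `u_s = u_0`),
with tails `γ_0 = ω_D`, `γ_i = [u_i, u_{i+1}, …]` for `i ≥ 1`. -/
structure CFData (D : ℕ) (u : ℕ → ℕ) (γ : ℕ → ℝ) : Prop where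
  gamma_zero : γ 0 = omegaD D
  u_zero : (u 0 : ℤ) = 2 * ⌊omegaD D⌋ - (if D % 4 = 1 then 1 else 0)
  head : omegaD D = (⌊omegaD D⌋ : ℝ) + 1 / γ 1
  step : ∀ i, 1 ≤ i → γ i = u i + 1 / γ (i + 1)
  one_lt : ∀ i, 1 ≤ i → 1 < γ i
  floor_eq : ∀ i, 1 ≤ i → (u i : ℤ) = ⌊γ i⌋
  period : ∃ s, 1 ≤ s ∧ u s = u 0 ∧ ∀ i, 1 ≤ i → u (i + s) = u i

/-- The convergents `α_i = p_i + q_i ξ_D`, indexed by `i ≥ -1`. -/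
structure ConvData (D : ℕ) (u : ℕ → ℕ) (a : ℤ → OK) : Prop where
  neg_one : a (-1) = (1, 0)
  zero : a 0 = (⌊omegaD D⌋, 0) + (if D % 4 = 1 then ((-1 : ℤ), (1 : ℤ)) else (0, 1))
  recur : ∀ i : ℤ, -1 ≤ i → a (i + 2) = (u (i + 2).toNat : ℤ) • a (i + 1) + a i

/-- Semiconvergents `α_{i,r} = α_i + r·α_{i+1}`. -/
def semiconv (a : ℤ → OK) (i r : ℤ) : OK := a i + r • a (i + 1)

/-! ## Counting partitions in coordinates -/

/-- Partitions of `w` into parts satisfying `Q`. -/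
def Parts (Q : ℤ × ℤ → Prop) (w : ℤ × ℤ) : Set (Multiset (ℤ × ℤ)) :=
  {s | (∀ x ∈ s, Q x) ∧ s.sum = w}

/-- Enumeration of partitions of `w` with parts `w` or in `S`. -/
def gen (S : List (ℤ × ℤ)) : ℕ → ℤ × ℤ → List (Multiset (ℤ × ℤ))
  | 0, _ => []
  | n + 1, w => {w} :: (S.filter (fun x => w - x ∈ S)).flatMap
      (fun x => (gen S n (w - x)).map (fun s => x ::ₘ s))

lemma gen_sound (Q : ℤ × ℤ → Prop) (S : List (ℤ × ℤ)) (hS : ∀ x ∈ S, Q x) (n : ℕ) :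
    ∀ w, Q w → ∀ s ∈ gen S n w, s ∈ Parts Q w := by
  induction n with
  | zero => intro w _ s hs; simp [gen] at hs
  | succ n ih =>
    intro w hw s hs
    simp only [gen, List.mem_cons, List.mem_flatMap, List.mem_filter, List.mem_map,
      decide_eq_true_eq] at hs
    rcases hs with rfl | ⟨x, ⟨hx, hwx⟩, t, ht, rfl⟩
    · refine ⟨?_, by simp⟩
      intro x hx
      rw [Multiset.mem_singleton] at hx
      exact hx ▸ hw
    · obtain ⟨h1, h2⟩ := ih _ (hS _ hwx) t ht
      refine ⟨?_, by simp [h2]⟩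
      intro y hy
      rcases Multiset.mem_cons.1 hy with rfl | hy
      · exact hS _ hx
      · exact h1 y hy

lemma sum_pos_of_add (Q : ℤ × ℤ → Prop) (hadd : ∀ x y, Q x → Q y → Q (x + y))
    (t : Multiset (ℤ × ℤ)) : (∀ x ∈ t, Q x) → t ≠ 0 → Q t.sum := by
  induction t using Multiset.induction_on with
  | empty => intro _ h; exact absurd rfl h
  | cons a t ih =>
    intro h _
    rw [Multiset.sum_cons]
    by_cases ht : t = 0
    · subst ht; simpa using h a (by simp)
    · exact hadd _ _ (h a (by simp)) (ih (fun x hx => h x (by simp [hx])) ht)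

lemma gen_complete (Q : ℤ × ℤ → Prop) (hadd : ∀ x y, Q x → Q y → Q (x + y)) (h0 : ¬ Q 0)
    (S : List (ℤ × ℤ)) (α : ℤ × ℤ) (hS : ∀ x, Q x → Q (α - x) → x ∈ S)
    (a b : ℤ) (hl : ∀ x ∈ α :: S, 1 ≤ a * x.1 + b * x.2) (n : ℕ) :
    ∀ w, Q w → (w = α ∨ Q (α - w)) → a * w.1 + b * w.2 ≤ n → ∀ s ∈ Parts Q w, s ∈ gen S n w := by
  induction n with
  | zero =>
    intro w hw hwα hle s hs
    have : w ∈ α :: S := by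
      rcases hwα with rfl | h
      · simp
      · exact List.mem_cons_of_mem _ (hS w hw h)
    have := hl w this
    simp at hle
    omega
  | succ n ih =>
    intro w hw hwα hle s hs
    obtain ⟨h1, h2⟩ := hs
    simp only [gen, List.mem_cons, List.mem_flatMap, List.mem_filter, List.mem_map,
      decide_eq_true_eq]
    by_cases hs0 : s = 0
    · subst hs0
      simp at h2
      exact absurd (h2 ▸ hw) h0
    obtain ⟨x, hx⟩ := Multiset.exists_mem_of_ne_zero hs0
    obtain ⟨t, rfl⟩ := Multiset.exists_cons_of_mem hx
    rw [Multiset.sum_cons] at h2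
    by_cases ht : t = 0
    · subst ht
      left
      simp at h2
      subst h2; rfl
    right
    have hQx := h1 x hx
    have htQ : ∀ y ∈ t, Q y := fun y hy => h1 y (by simp [hy])
    have hQt := sum_pos_of_add Q hadd t htQ ht
    have e : t.sum = w - x := by rw [← h2]; abel
    rw [e] at hQt
    have hx1 : Q (α - x) := by
      rcases hwα with rfl | h
      · exact hQt
      · have := hadd _ _ h hQt
        rwa [show α - w + (w - x) = α - x by abel] at this
    have hx2 : Q (α - (w - x)) := by
      rcases hwα with rfl | h
      · simpa using hQx
      · have := hadd _ _ h hQx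
        rwa [show α - w + x = α - (w - x) by abel] at this
    have hxS := hS x hQx hx1
    have := hl x (List.mem_cons_of_mem _ hxS)
    refine ⟨x, ⟨hxS, hS _ hQt hx2⟩, t, ih _ hQt (Or.inr hx2) ?_ t ⟨htQ, e⟩, rfl⟩
    push_cast at hle
    simp only [Prod.fst_sub, Prod.snd_sub]
    linarith

lemma cnt_le (Q : ℤ × ℤ → Prop) (hadd : ∀ x y, Q x → Q y → Q (x + y)) (h0 : ¬ Q 0)
    (S : List (ℤ × ℤ)) (α : ℤ × ℤ) (hα : Q α) (hS : ∀ x, Q x → Q (α - x) → x ∈ S)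
    (a b : ℤ) (n : ℕ) (hl : ∀ x ∈ α :: S, 1 ≤ a * x.1 + b * x.2)
    (hn : a * α.1 + b * α.2 ≤ n) :
    (Parts Q α).ncard ≤ (gen S n α).toFinset.card := by
  rw [← Set.ncard_coe_finset]
  apply Set.ncard_le_ncard _ (Finset.finite_toSet _)
  intro s hs
  simpa using gen_complete Q hadd h0 S α hS a b hl n α hα (Or.inl rfl) hn s hs

lemma cnt_eq (Q : ℤ × ℤ → Prop) (hadd : ∀ x y, Q x → Q y → Q (x + y)) (h0 : ¬ Q 0)
    (S : List (ℤ × ℤ)) (α : ℤ × ℤ) (hα : Q α) (hS : ∀ x, Q x → Q (α - x) → x ∈ S)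
    (hS' : ∀ x ∈ S, Q x)
    (a b : ℤ) (n : ℕ) (hl : ∀ x ∈ α :: S, 1 ≤ a * x.1 + b * x.2)
    (hn : a * α.1 + b * α.2 ≤ n) :
    (Parts Q α).ncard = (gen S n α).toFinset.card := by
  rw [← Set.ncard_coe_finset]
  congr 1
  ext s
  simp only [List.coe_toFinset, Set.mem_ofPred_eq]
  exact ⟨gen_complete Q hadd h0 S α hS a b hl n α hα (Or.inl rfl) hn s,
    gen_sound Q S hS' n α hα s⟩

lemma cnt_ge (Q : ℤ × ℤ → Prop) (S : List (ℤ × ℤ)) (α : ℤ × ℤ) (hα : Q α)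
    (hS' : ∀ x ∈ S, Q x) (n : ℕ) (h : (Parts Q α).ncard = 6) :
    (gen S n α).toFinset.card ≤ 6 := by
  rw [← h, ← Set.ncard_coe_finset]
  apply Set.ncard_le_ncard
  · intro s hs
    exact gen_sound Q S hS' n α hα s (by simpa using hs)
  · exact Set.finite_of_ncard_ne_zero (by omega)

/-- Monotonicity: if `α + τ` has exactly six partitions then any finset of partitions of `α` has
at most six elements. -/
lemma cnt_ge_add (Q : ℤ × ℤ → Prop) (S : List (ℤ × ℤ)) (α τ : ℤ × ℤ) (hα : Q α)
    (hτ : τ = 0 ∨ Q τ)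
    (hS' : ∀ x ∈ S, Q x) (n : ℕ) (h : (Parts Q (α + τ)).ncard = 6) :
    (gen S n α).toFinset.card ≤ 6 := by
  rcases hτ with rfl | hτ
  · rw [add_zero] at h
    exact cnt_ge Q S α hα hS' n h
  rw [← h, ← Set.ncard_coe_finset]
  have hfin : (Parts Q (α + τ)).Finite := Set.finite_of_ncard_ne_zero (by omega)
  apply Set.ncard_le_ncard_of_injOn (fun s => τ ::ₘ s) (ht := hfin)
  · intro s hs
    obtain ⟨h1, h2⟩ := gen_sound Q S hS' n α hα s (by simpa using hs)
    refine ⟨?_, by simp [h2, add_comm]⟩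
    intro y hy
    rcases Multiset.mem_cons.1 hy with rfl | hy
    · exact hτ
    · exact h1 y hy
  · intro s _ t _ hst
    simpa using hst

/-! ## Abstract chains -/

/-- Determinant. -/
def det2 (b c : ℤ × ℤ) : ℤ := b.1 * c.2 - b.2 * c.1

/-- Linear combination. -/
def lin (b c q : ℤ × ℤ) : ℤ × ℤ := q.1 • b + q.2 • c

structure Chain (P : ℤ × ℤ → Prop) (β : ℤ → ℤ × ℤ) (v : ℤ → ℤ) : Prop where
  add : ∀ x y, P x → P y → P (x + y)
  zero : ¬ P 0
  pos : ∀ j, P (β j)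
  two : ∀ j, 2 ≤ v j
  rel : ∀ j, v j • β j = β (j - 1) + β (j + 1)
  det : ∀ j, det2 (β j) (β (j + 1)) * det2 (β j) (β (j + 1)) = 1
  n1 : ∀ j x y, P (lin (β j) (β (j + 1)) (x, y)) → y < 0 → (v j - 1) * (-y) + 1 ≤ x
  n2 : ∀ j x y, P (lin (β j) (β (j + 1)) (x, y)) → x < 0 → (v (j + 1) - 1) * (-x) + 1 ≤ y
  cover : ∀ x, P x → ∃ j, ∃ e f : ℤ, 0 ≤ e ∧ 0 ≤ f ∧ x = lin (β j) (β (j + 1)) (e, f)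

lemma lin_swap (b c : ℤ × ℤ) (x y : ℤ) : lin b c (x, y) = lin c b (y, x) := by
  simp [lin, add_comm]

lemma Chain.rev {P β v} (C : Chain P β v) : Chain P (fun j => β (-j)) (fun j => v (-j)) where
  add := C.add
  zero := C.zero
  pos j := C.pos _
  two j := C.two _
  rel j := by
    have := C.rel (-j)
    rw [show -(j - 1) = -j + 1 by ring, show -(j + 1) = -j - 1 by ring, this, add_comm]
  det j := by
    have := C.det (-(j + 1))
    rw [show -(j + 1) + 1 = -j by ring] at this
    simp only [det2] at this ⊢; linear_combination this
  n1 j x y h hy := by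
    have := C.n2 (-(j + 1)) y x
    rw [show -(j + 1) + 1 = -j by ring] at this
    exact this (lin_swap _ _ _ _ ▸ h) hy
  n2 j x y h hy := by
    have := C.n1 (-(j + 1)) y x
    rw [show -(j + 1) + 1 = -j by ring] at this
    exact this (lin_swap _ _ _ _ ▸ h) hy
  cover x hx := by
    obtain ⟨j, e, f, he, hf, h⟩ := C.cover x hx
    refine ⟨-(j + 1), f, e, hf, he, ?_⟩
    rw [h, lin_swap]
    rw [show -(-(j + 1) + 1) = j by ring, neg_neg]

lemma lin_inj (b c : ℤ × ℤ) (h : det2 b c * det2 b c = 1) : Function.Injective (lin b c) := by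
  rintro ⟨x, y⟩ ⟨x', y'⟩ hh
  simp only [lin, Prod.ext_iff, Prod.fst_add, Prod.snd_add, Prod.smul_fst, Prod.smul_snd,
    smul_eq_mul] at hh
  obtain ⟨h1, h2⟩ := hh
  have hd : det2 b c ≠ 0 := by rintro h'; rw [h'] at h; norm_num at h
  have e1 : det2 b c * (x - x') = 0 := by
    simp only [det2]; linear_combination c.2 * h1 - c.1 * h2
  have e2 : det2 b c * (y - y') = 0 := by
    simp only [det2]; linear_combination b.1 * h2 - b.2 * h1
  have := (mul_eq_zero.1 e1).resolve_left hd
  have := (mul_eq_zero.1 e2).resolve_left hd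
  ext <;> simp <;> omega

lemma lin_surj (b c : ℤ × ℤ) (h : det2 b c * det2 b c = 1) (z : ℤ × ℤ) : ∃ q, lin b c q = z := by
  refine ⟨(det2 b c * det2 z c, det2 b c * det2 b z), ?_⟩
  have e1 : det2 z c * b.1 + det2 b z * c.1 = det2 b c * z.1 := by simp only [det2]; ring
  have e2 : det2 z c * b.2 + det2 b z * c.2 = det2 b c * z.2 := by simp only [det2]; ring
  ext
  · simp only [lin, Prod.fst_add, Prod.smul_fst, smul_eq_mul]
    linear_combination det2 b c * e1 + z.1 * h
  · simp only [lin, Prod.snd_add, Prod.smul_snd, smul_eq_mul]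
    linear_combination det2 b c * e2 + z.2 * h

lemma lin_add (b c q r : ℤ × ℤ) : lin b c (q + r) = lin b c q + lin b c r := by
  ext <;> simp [lin] <;> ring

/-- `lin` as an additive hom -/
def linHom (b c : ℤ × ℤ) : (ℤ × ℤ) →+ (ℤ × ℤ) where
  toFun := lin b c
  map_zero' := by simp [lin]
  map_add' := lin_add b c

lemma cnt_lin (P : ℤ × ℤ → Prop) (b c : ℤ × ℤ) (h : det2 b c * det2 b c = 1) (w : ℤ × ℤ) :
    (Parts P (lin b c w)).ncard = (Parts (fun q => P (lin b c q)) w).ncard := by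
  have hinj := lin_inj b c h
  rw [← Set.ncard_image_of_injective (Parts (fun q => P (lin b c q)) w)
    (Multiset.map_injective hinj)]
  congr 1
  ext s
  have hsum : ∀ t : Multiset (ℤ × ℤ), (t.map (lin b c)).sum = lin b c t.sum := fun t =>
    (map_multiset_sum (linHom b c) t).symm
  constructor
  · rintro ⟨h1, h2⟩
    choose g hg using lin_surj b c h
    have e : (s.map g).map (lin b c) = s := by simp [Multiset.map_map, hg]
    refine ⟨s.map g, ⟨?_, ?_⟩, e⟩
    · intro x hx
      obtain ⟨y, hy, rfl⟩ := Multiset.mem_map.1 hx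
      simpa [hg] using h1 y hy
    · apply hinj
      rw [← hsum, e, h2]
  · rintro ⟨t, ⟨h1, h2⟩, rfl⟩
    refine ⟨?_, by rw [hsum, h2]⟩
    intro x hx
    obtain ⟨y, hy, rfl⟩ := Multiset.mem_map.1 hx
    exact h1 y hy

/-- The local data in coordinates. -/
structure Loc (Q : ℤ × ℤ → Prop) (v w : ℤ) : Prop where
  add : ∀ x y, Q x → Q y → Q (x + y)
  zero : ¬ Q 0
  q10 : Q (1, 0)
  q01 : Q (0, 1)
  qa : Q (v, -1)
  qb : Q (-1, w)
  v2 : 2 ≤ v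
  w2 : 2 ≤ w
  n1 : ∀ x y, Q (x, y) → y < 0 → (v - 1) * (-y) + 1 ≤ x
  n2 : ∀ x y, Q (x, y) → x < 0 → (w - 1) * (-x) + 1 ≤ y

section
variable {P : ℤ × ℤ → Prop} {β : ℤ → ℤ × ℤ} {v : ℤ → ℤ}

lemma Chain.prev (C : Chain P β v) (j : ℤ) : β (j - 1) = lin (β j) (β (j + 1)) (v j, -1) := by
  have := C.rel j
  simp only [lin, this]
  simp

lemma Chain.next (C : Chain P β v) (j : ℤ) :
    β (j + 2) = lin (β j) (β (j + 1)) (-1, v (j + 1)) := by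
  have := C.rel (j + 1)
  simp only [lin, this]
  rw [show j + 1 - 1 = j by ring, show j + 1 + 1 = j + 2 by ring]
  simp

lemma Chain.loc (C : Chain P β v) (j : ℤ) :
    Loc (fun q => P (lin (β j) (β (j + 1)) q)) (v j) (v (j + 1)) where
  add x y hx hy := by rw [lin_add]; exact C.add _ _ hx hy
  zero := by simpa [lin] using C.zero
  q10 := by simpa [lin] using C.pos j
  q01 := by simpa [lin] using C.pos (j + 1)
  qa := by rw [← C.prev]; exact C.pos _
  qb := by rw [← C.next]; exact C.pos _
  v2 := C.two _
  w2 := C.two _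
  n1 := C.n1 j
  n2 := C.n2 j

end
/-! ## Local counts -/

section
variable {Q : ℤ × ℤ → Prop} {v w : ℤ}

lemma Loc.swap (L : Loc Q v w) : Loc (fun q => Q (q.2, q.1)) w v where
  add x y hx hy := L.add _ _ hx hy
  zero := L.zero
  q10 := L.q01
  q01 := L.q10
  qa := L.qb
  qb := L.qa
  v2 := L.w2
  w2 := L.v2
  n1 x y h := L.n2 y x h
  n2 x y h := L.n1 y x h

lemma Loc.k1 (L : Loc Q v w) (c : ℤ) (hc : c ≤ v) {x y : ℤ} (h : Q (x, y)) (hy : y < 0) :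
    (c - 1) * (-y) + 1 ≤ x := by
  have := L.n1 x y h hy
  nlinarith

lemma Loc.k2 (L : Loc Q v w) (c : ℤ) (hc : c ≤ w) {x y : ℤ} (h : Q (x, y)) (hx : x < 0) :
    (c - 1) * (-x) + 1 ≤ y := by
  have := L.n2 x y h hx
  nlinarith

lemma Loc.ne (L : Loc Q v w) {x y : ℤ} (h : Q (x, y)) : x ≠ 0 ∨ y ≠ 0 := by
  by_contra! h'
  obtain ⟨rfl, rfl⟩ := h'
  exact L.zero h

lemma Loc.nonneg (L : Loc Q v w) (x y : ℕ) (h : 1 ≤ x + y) : Q ((x : ℤ), (y : ℤ)) := by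
  induction x with
  | zero =>
    induction y with
    | zero => omega
    | succ y ih =>
      by_cases hy : y = 0
      · subst hy; simpa using L.q01
      · have := L.add _ _ (ih (by omega)) L.q01
        simpa using this
  | succ x ih =>
    by_cases hx : x + y = 0
    · obtain ⟨rfl, rfl⟩ : x = 0 ∧ y = 0 := by omega
      simpa using L.q10
    · have := L.add _ _ (ih (by omega)) L.q10
      simpa using this

lemma Loc.nonneg' (L : Loc Q v w) (x y : ℤ) (hx : 0 ≤ x) (hy : 0 ≤ y) (h : 1 ≤ x + y) :
    Q (x, y) := by
  lift x to ℕ using hx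
  lift y to ℕ using hy
  exact L.nonneg x y (by omega)

lemma Loc.four (L : Loc Q 4 w) : (Parts Q (4, 0)).ncard = 6 := by
  rw [cnt_eq Q L.add L.zero [(1,0),(2,0),(3,0),(0,1),(4,-1)] (4,0)
    (L.nonneg' _ _ (by decide) (by decide) (by decide)) ?_ ?_ 1 1 4 (by decide) (by decide)]
  · decide +kernel
  · rintro ⟨x, y⟩ h1 h2
    have a1 := L.k1 4 (by norm_num) h1
    have a2 := L.k2 2 L.w2 h1
    have a3 := L.ne h1
    have b1 := L.k1 4 (by norm_num) h2
    have b2 := L.k2 2 L.w2 h2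
    have b3 := L.ne h2
    simp only [List.mem_cons, Prod.mk.injEq, List.not_mem_nil, or_false]
    simp only [] at b1 b2 b3
    omega
  · intro x hx
    simp only [List.mem_cons, List.not_mem_nil, or_false] at hx
    rcases hx with rfl | rfl | rfl | rfl | rfl
    all_goals first | exact L.qa | exact L.nonneg' _ _ (by decide) (by decide) (by decide)

lemma Loc.iso (L : Loc Q 2 w) (hw : 3 ≤ w) (hx : ¬ Q (3, -2)) (hx' : ¬ Q (4, -3)) : (Parts Q (3, 0)).ncard = 6 := by
  rw [cnt_eq Q L.add L.zero [(1,0),(2,0),(0,1),(1,1),(2,-1),(3,-1)] (3,0)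
    (L.nonneg' _ _ (by decide) (by decide) (by decide)) ?_ ?_ 1 1 3 (by decide) (by decide)]
  · decide +kernel
  · rintro ⟨x, y⟩ h1 h2
    have a1 := L.k1 2 (by norm_num) h1
    have a2 := L.k2 3 hw h1
    have a3 := L.ne h1
    have b1 := L.k1 2 (by norm_num) h2
    have b2 := L.k2 3 hw h2
    have b3 := L.ne h2
    have c1 : ¬ (x = 3 ∧ y = -2) := by rintro ⟨rfl, rfl⟩; exact hx h1
    have c3 : ¬ (x = -1 ∧ y = 3) := by rintro ⟨rfl, rfl⟩; exact hx' h2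
    have c4 : ¬ (x = 4 ∧ y = -3) := by rintro ⟨rfl, rfl⟩; exact hx' h1
    have c2 : ¬ (x = 0 ∧ y = 2) := by rintro ⟨rfl, rfl⟩; exact hx h2
    simp only [] at b1 b2 b3
    have y1 : y ≤ 3 := by clear c1 c2 c3 c4; omega
    have y2 : -3 ≤ y := by clear c1 c2 c3 c4; omega
    have x1 : x ≤ 4 := by clear c1 c2 c3 c4; omega
    have x2 : -1 ≤ x := by clear c1 c2 c3 c4; omega
    clear h1 h2
    interval_cases x <;> interval_cases y <;> first | decide | (exfalso; omega)
  · intro x hx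
    simp only [List.mem_cons, List.not_mem_nil, or_false] at hx
    rcases hx with rfl | rfl | rfl | rfl | rfl | rfl
    all_goals first
      | exact L.qa
      | exact L.nonneg' _ _ (by decide) (by decide) (by decide)
      | exact L.add (2, -1) (1, 0) L.qa L.q10

lemma Loc.adj (L : Loc Q 2 w) (hw : 4 ≤ w) : (Parts Q (2, 1)).ncard = 6 := by
  rw [cnt_eq Q L.add L.zero [(1,0),(2,0),(0,1),(1,1),(2,-1),(0,2)] (2,1)
    (L.nonneg' _ _ (by decide) (by decide) (by decide)) ?_ ?_ 1 1 3 (by decide) (by decide)]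
  · decide +kernel
  · rintro ⟨x, y⟩ h1 h2
    have a1 := L.k1 2 (by norm_num) h1
    have a2 := L.k2 4 hw h1
    have a3 := L.ne h1
    have b1 := L.k1 2 (by norm_num) h2
    have b2 := L.k2 4 hw h2
    have b3 := L.ne h2
    simp only [List.mem_cons, Prod.mk.injEq, List.not_mem_nil, or_false]
    simp only [] at b1 b2 b3
    omega
  · intro x hx
    simp only [List.mem_cons, List.not_mem_nil, or_false] at hx
    rcases hx with rfl | rfl | rfl | rfl | rfl | rfl
    all_goals first
      | exact L.qa
      | exact L.nonneg' _ _ (by decide) (by decide) (by decide)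

lemma Loc.run (L : Loc Q v w) (hv : 3 ≤ v)
    (h : ∀ k : ℤ, 0 ≤ k → k ≤ 8 → Q (1 - k, k)) : (Parts Q (-6, 8)).ncard = 6 := by
  rw [cnt_eq Q L.add L.zero [(1,0),(0,1),(-1,2),(-2,3),(-3,4),(-4,5),(-5,6),(-6,7),(-7,8)] (-6,8)
    (L.add (1, 0) (1 - 8, 8) L.q10 (h 8 (by norm_num) (by norm_num))) ?_ ?_ 1 1 2
    (by decide) (by decide)]
  · decide +kernel
  · rintro ⟨x, y⟩ h1 h2
    have a1 := L.k1 3 hv h1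
    have a2 := L.k2 2 L.w2 h1
    have a3 := L.ne h1
    have b1 := L.k1 3 hv h2
    have b2 := L.k2 2 L.w2 h2
    have b3 := L.ne h2
    simp only [] at b1 b2 b3
    have y1 : y ≤ 8 := by omega
    have y2 : 0 ≤ y := by omega
    obtain rfl : x = 1 - y := by omega
    clear h1 h2 a1 a2 a3 b1 b2 b3
    interval_cases y <;> decide
  · intro x hx
    simp only [List.mem_cons, List.not_mem_nil, or_false] at hx
    rcases hx with rfl | rfl | rfl | rfl | rfl | rfl | rfl | rfl | rfl
    · exact h 0 (by norm_num) (by norm_num)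
    · exact h 1 (by norm_num) (by norm_num)
    · exact h 2 (by norm_num) (by norm_num)
    · exact h 3 (by norm_num) (by norm_num)
    · exact h 4 (by norm_num) (by norm_num)
    · exact h 5 (by norm_num) (by norm_num)
    · exact h 6 (by norm_num) (by norm_num)
    · exact h 7 (by norm_num) (by norm_num)
    · exact h 8 (by norm_num) (by norm_num)

/-- Upper bounds. -/
lemma Loc.up10 (L : Loc Q v w) : (Parts Q (1, 0)).ncard ≠ 6 := by
  have h := cnt_le Q L.add L.zero [] (1,0) L.q10 ?_ 1 1 1 (by decide) (by decide)
  · have e : (gen [] 1 (1,0)).toFinset.card ≤ 5 := by decide +kernel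
    omega
  · rintro ⟨x, y⟩ h1 h2
    have a1 := L.k1 2 L.v2 h1
    have a2 := L.k2 2 L.w2 h1
    have a3 := L.ne h1
    have b1 := L.k1 2 L.v2 h2
    have b2 := L.k2 2 L.w2 h2
    have b3 := L.ne h2
    simp only [] at b1 b2 b3
    omega

lemma Loc.up30 (L : Loc Q v w) (hv : 3 ≤ v) : (Parts Q (3, 0)).ncard ≠ 6 := by
  have h := cnt_le Q L.add L.zero [(1,0),(2,0),(0,1),(3,-1)] (3,0)
    (L.nonneg' _ _ (by decide) (by decide) (by decide)) ?_ 1 1 3 (by decide) (by decide)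
  · have e : (gen [(1,0),(2,0),(0,1),(3,-1)] 3 (3,0)).toFinset.card ≤ 5 := by decide +kernel
    omega
  · rintro ⟨x, y⟩ h1 h2
    have a1 := L.k1 3 hv h1
    have a2 := L.k2 2 L.w2 h1
    have a3 := L.ne h1
    have b1 := L.k1 3 hv h2
    have b2 := L.k2 2 L.w2 h2
    have b3 := L.ne h2
    simp only [List.mem_cons, Prod.mk.injEq, List.not_mem_nil, or_false]
    simp only [] at b1 b2 b3
    omega

lemma Loc.up40 (L : Loc Q v w) (hv : 5 ≤ v) : (Parts Q (4, 0)).ncard ≠ 6 := by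
  have h := cnt_le Q L.add L.zero [(1,0),(2,0),(3,0)] (4,0)
    (L.nonneg' _ _ (by decide) (by decide) (by decide)) ?_ 1 1 4 (by decide) (by decide)
  · have e : (gen [(1,0),(2,0),(3,0)] 4 (4,0)).toFinset.card ≤ 5 := by decide +kernel
    omega
  · rintro ⟨x, y⟩ h1 h2
    have a1 := L.k1 5 hv h1
    have a2 := L.k2 2 L.w2 h1
    have a3 := L.ne h1
    have b1 := L.k1 5 hv h2
    have b2 := L.k2 2 L.w2 h2
    have b3 := L.ne h2
    simp only [List.mem_cons, Prod.mk.injEq, List.not_mem_nil, or_false]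
    simp only [] at b1 b2 b3
    omega

lemma Loc.up21 (L : Loc Q v w) (hv : 3 ≤ v) : (Parts Q (2, 1)).ncard ≠ 6 := by
  have h := cnt_le Q L.add L.zero [(1,0),(2,0),(0,1),(1,1),(-1,2),(3,-1)] (2,1)
    (L.nonneg' _ _ (by decide) (by decide) (by decide)) ?_ 1 1 3 (by decide) (by decide)
  · have e : (gen [(1,0),(2,0),(0,1),(1,1),(-1,2),(3,-1)] 3 (2,1)).toFinset.card ≤ 5 := by
      decide +kernel
    omega
  · rintro ⟨x, y⟩ h1 h2
    have a1 := L.k1 3 hv h1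
    have a2 := L.k2 2 L.w2 h1
    have a3 := L.ne h1
    have b1 := L.k1 3 hv h2
    have b2 := L.k2 2 L.w2 h2
    have b3 := L.ne h2
    simp only [List.mem_cons, Prod.mk.injEq, List.not_mem_nil, or_false]
    simp only [] at b1 b2 b3
    omega

lemma Loc.uprun (L : Loc Q v w) (hv : 3 ≤ v) (m : ℤ) (hm0 : 0 ≤ m) (hm : m ≤ 7)
    (hα : Q (2 - m, m)) : (Parts Q (2 - m, m)).ncard ≠ 6 := by
  have hS : ∀ x, Q x → Q ((2 - m, m) - x) →
      x ∈ (List.range (m.toNat + 1)).map (fun k : ℕ => ((1 - k : ℤ), (k : ℤ))) := by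
    rintro ⟨x, y⟩ h1 h2
    have a1 := L.k1 3 hv h1
    have a2 := L.k2 2 L.w2 h1
    have a3 := L.ne h1
    have b1 := L.k1 3 hv h2
    have b2 := L.k2 2 L.w2 h2
    have b3 := L.ne h2
    simp only [List.mem_map, List.mem_range, Prod.mk.injEq]
    simp only [] at b1 b2 b3
    exact ⟨y.toNat, by omega, by omega, by omega⟩
  have h := cnt_le Q L.add L.zero _ (2 - m, m) hα hS 1 1 2
  have e : (gen ((List.range (m.toNat + 1)).map (fun k : ℕ => ((1 - k : ℤ), (k : ℤ)))) 2
      (2 - m, m)).toFinset.card ≤ 5 := by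
    interval_cases m <;> decide +kernel
  have := h (by interval_cases m <;> decide +kernel) (by simp)
  omega

/-- Lower bounds. -/
lemma Loc.low50 (L : Loc Q v w) (e f : ℤ) (he : 0 ≤ e) (hf : 0 ≤ f)
    (h : 5 ≤ e ∨ (3 ≤ e ∧ 1 ≤ f) ∨ (2 ≤ e ∧ 2 ≤ f)) :
    (Parts Q (e, f)).ncard ≠ 6 := by
  intro h6
  have key : ∀ (S : List (ℤ × ℤ)) (a b : ℤ), (∀ x ∈ S, 0 ≤ x.1 ∧ 0 ≤ x.2 ∧ 1 ≤ x.1 + x.2) →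
      0 ≤ a → 0 ≤ b → 1 ≤ a + b → a ≤ e → b ≤ f → (gen S 5 (a, b)).toFinset.card ≤ 6 := by
    intro S a b hS ha hb hab hae hbf
    apply cnt_ge_add Q S (a, b) (e - a, f - b) (L.nonneg' _ _ ha hb hab)
    · by_cases h0 : e - a = 0 ∧ f - b = 0
      · left; simp [h0.1, h0.2]
      · right; exact L.nonneg' _ _ (by omega) (by omega) (by omega)
    · rintro ⟨x, y⟩ hx
      obtain ⟨h1, h2, h3⟩ := hS _ hx
      exact L.nonneg' _ _ h1 h2 h3
    · simpa using h6
  rcases h with h | ⟨h, h'⟩ | ⟨h, h'⟩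
  · exact absurd (key [(1,0),(2,0),(3,0),(4,0)] 5 0 (by decide) (by decide) (by decide) (by decide)
      h hf) (by decide +kernel)
  · exact absurd (key [(1,0),(2,0),(3,0),(0,1),(1,1),(2,1)] 3 1 (by decide) (by decide) (by decide)
      (by decide) h h') (by decide +kernel)
  · exact absurd (key [(1,0),(2,0),(0,1),(0,2),(1,1),(2,1),(1,2)] 2 2 (by decide) (by decide)
      (by decide) (by decide) h h') (by decide +kernel)

lemma Loc.low (S : List (ℤ × ℤ)) (α : ℤ × ℤ) (h6 : 7 ≤ (gen S 5 α).toFinset.card)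
    (hα : Q α) (hS : ∀ x ∈ S, Q x) : (Parts Q α).ncard ≠ 6 := by
  intro h
  have := cnt_ge Q S α hα hS 5 h
  omega

lemma Loc.low30 (L : Loc Q 2 2) : (Parts Q (3, 0)).ncard ≠ 6 := by
  apply Loc.low [(1,0),(2,0),(0,1),(2,-1),(-1,2),(1,1),(3,-1)] _ (by decide +kernel)
    (L.nonneg' _ _ (by decide) (by decide) (by decide))
  intro x hx
  simp only [List.mem_cons, List.not_mem_nil, or_false] at hx
  rcases hx with rfl | rfl | rfl | rfl | rfl | rfl | rfl
  all_goals first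
    | exact L.qa
    | exact L.qb
    | exact L.nonneg' _ _ (by decide) (by decide) (by decide)
    | exact L.add (2, -1) (1, 0) L.qa L.q10

lemma Loc.low40 (L : Loc Q v w) (hv : v ≤ 3) : (Parts Q (4, 0)).ncard ≠ 6 := by
  have h3 : Q (3, -1) := by
    have := L.v2
    obtain rfl | rfl : v = 2 ∨ v = 3 := by omega
    · exact L.add (2, -1) (1, 0) L.qa L.q10
    · exact L.qa
  apply Loc.low [(1,0),(2,0),(3,0),(0,1),(3,-1),(1,1),(4,-1)] _ (by decide +kernel)
    (L.nonneg' _ _ (by decide) (by decide) (by decide))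
  intro x hx
  simp only [List.mem_cons, List.not_mem_nil, or_false] at hx
  rcases hx with rfl | rfl | rfl | rfl | rfl | rfl | rfl
  all_goals first
    | exact h3
    | exact L.nonneg' _ _ (by decide) (by decide) (by decide)
    | exact L.add (3, -1) (1, 0) h3 L.q10

lemma Loc.low21a (L : Loc Q 2 2) : (Parts Q (2, 1)).ncard ≠ 6 := by
  apply Loc.low [(1,0),(2,0),(0,1),(2,-1),(-1,2),(1,1),(3,-1),(0,2)] _ (by decide +kernel)
    (L.nonneg' _ _ (by decide) (by decide) (by decide))
  intro x hx
  simp only [List.mem_cons, List.not_mem_nil, or_false] at hx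
  rcases hx with rfl | rfl | rfl | rfl | rfl | rfl | rfl | rfl
  all_goals first
    | exact L.qa
    | exact L.qb
    | exact L.nonneg' _ _ (by decide) (by decide) (by decide)
    | exact L.add (2, -1) (1, 0) L.qa L.q10

lemma Loc.low21b (L : Loc Q 2 3) (h : Q (3, -2)) : (Parts Q (2, 1)).ncard ≠ 6 := by
  apply Loc.low [(1,0),(2,0),(0,1),(2,-1),(-1,3),(1,1),(3,-2),(0,2)] _ (by decide +kernel)
    (L.nonneg' _ _ (by decide) (by decide) (by decide))
  intro x hx
  simp only [List.mem_cons, List.not_mem_nil, or_false] at hx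
  rcases hx with rfl | rfl | rfl | rfl | rfl | rfl | rfl | rfl
  all_goals first
    | exact h
    | exact L.qa
    | exact L.qb
    | exact L.nonneg' _ _ (by decide) (by decide) (by decide)

end
/-! ## Global consequences for chains -/

section
variable {P : ℤ × ℤ → Prop} {β : ℤ → ℤ × ℤ} {v : ℤ → ℤ}

lemma Chain.ex (C : Chain P β v) (j : ℤ) (w : ℤ × ℤ) (hw : 0 ≤ w.1 ∧ 0 ≤ w.2 ∧ 1 ≤ w.1 + w.2)
    (h : (Parts (fun q => P (lin (β j) (β (j + 1)) q)) w).ncard = 6) :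
    ∃ α, P α ∧ (Parts P α).ncard = 6 :=
  ⟨lin (β j) (β (j + 1)) w, (C.loc j).nonneg' _ _ hw.1 hw.2.1 hw.2.2, by
    rw [cnt_lin P _ _ (C.det j)]; exact h⟩

lemma Chain.run_coord (C : Chain P β v) (j : ℤ) (n : ℕ) :
    (∀ x, j < x → x < j + n → v x = 2) →
      β (j + n) = lin (β j) (β (j + 1)) (1 - n, n) := by
  induction n using Nat.strong_induction_on with
  | _ n ih =>
    intro h
    match n, ih, h with
    | 0, _, _ => simp [lin]
    | 1, _, _ => simp [lin]
    | n + 2, ih, h =>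
      have e1 := ih n (by omega) (fun x h1 h2 => h x h1 (by push_cast; omega))
      have e2 := ih (n + 1) (by omega) (fun x h1 h2 => h x h1 (by push_cast at h2 ⊢; omega))
      have r := C.next (j + n)
      have hv : v (j + n + 1) = 2 := h _ (by omega) (by push_cast; omega)
      push_cast at e2 ⊢
      rw [show j + (n + 2 : ℤ) = j + n + 2 by ring, r, hv, e1,
        show j + (n : ℤ) + 1 = j + (n + 1) by ring, e2]
      ext <;> simp [lin] <;> ring

lemma Chain.fwd4 (C : Chain P β v) (j : ℤ) (h : v j = 4) : ∃ α, P α ∧ (Parts P α).ncard = 6 := by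
  have L := C.loc j
  rw [h] at L
  exact C.ex j (4, 0) (by norm_num) L.four

lemma Chain.lin_shift (C : Chain P β v) (j : ℤ) (x y : ℤ) :
    lin (β (j - 1)) (β (j - 1 + 1)) (-y, x + v j * y) = lin (β j) (β (j + 1)) (x, y) := by
  rw [sub_add_cancel, C.prev j]
  ext <;> simp [lin] <;> ring

lemma Chain.fwdIso (C : Chain P β v) (j : ℤ) (h : v j = 2) (h1 : 3 ≤ v (j - 1))
    (h2 : 3 ≤ v (j + 1)) : ∃ α, P α ∧ (Parts P α).ncard = 6 := by
  have L := C.loc j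
  rw [h] at L
  have n := C.n1 (j - 1)
  have s := C.lin_shift j
  refine C.ex j (3, 0) (by norm_num) (L.iso h2 ?_ ?_)
  · intro hq
    rw [← s, h] at hq
    have := n _ _ hq (by norm_num)
    norm_num at this
    omega
  · intro hq
    rw [← s, h] at hq
    have := n _ _ hq (by norm_num)
    norm_num at this
    omega

lemma Chain.fwdAdj (C : Chain P β v) (j : ℤ) (h : v j = 2) (h2 : 4 ≤ v (j + 1)) :
    ∃ α, P α ∧ (Parts P α).ncard = 6 := by
  have L := C.loc j
  rw [h] at L
  exact C.ex j (2, 1) (by norm_num) (L.adj h2)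

lemma Chain.fwdAdj' (C : Chain P β v) (j : ℤ) (h : v j = 2) (h2 : 4 ≤ v (j - 1)) :
    ∃ α, P α ∧ (Parts P α).ncard = 6 := by
  apply C.rev.fwdAdj (-j)
  · simpa using h
  · rwa [show -(-j + 1) = j - 1 by ring]

lemma Chain.fwdRun (C : Chain P β v) (j : ℤ) (h : 3 ≤ v j)
    (h2 : ∀ x, j < x → x < j + 8 → v x = 2) :
    ∃ α, P α ∧ (Parts P α).ncard = 6 := by
  have L := C.loc j
  have hk : ∀ k : ℤ, 0 ≤ k → k ≤ 8 → P (lin (β j) (β (j + 1)) (1 - k, k)) := by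
    intro k h0 h8
    lift k to ℕ using h0
    rw [← C.run_coord j k (fun x h1 h3 => h2 x h1 (by omega))]
    exact C.pos _
  have := L.run h hk
  refine ⟨lin (β j) (β (j + 1)) (-6, 8), L.add (1, 0) (1 - 8, 8) L.q10
    (hk 8 (by norm_num) (by norm_num)), ?_⟩
  rw [cnt_lin P _ _ (C.det j)]; exact this

/-- None of the six-partition patterns occurs. -/
structure NoPat (v : ℤ → ℤ) : Prop where
  run : ∀ j, ¬ (∀ x, j ≤ x → x ≤ j + 6 → v x = 2)
  four : ∀ j, v j ≠ 4
  iso : ∀ j, v j = 2 → 3 ≤ v (j - 1) → 3 ≤ v (j + 1) → False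
  adj : ∀ j, v j = 2 → 4 ≤ v (j + 1) → False
  adj' : ∀ j, v j = 2 → 4 ≤ v (j - 1) → False

lemma NoPat.rev (N : NoPat v) : NoPat (fun j => v (-j)) where
  run j h := by
    apply N.run (-j - 6)
    intro x h1 h2
    have := h (-x) (by omega) (by omega)
    simpa using this
  four j := N.four _
  iso j h h1 h2 := N.iso (-j) h (by rwa [show -j - 1 = -(j + 1) by ring])
    (by rwa [show -j + 1 = -(j - 1) by ring])
  adj j h h1 := N.adj' (-j) h (by rwa [show -j - 1 = -(j + 1) by ring])
  adj' j h h1 := N.adj (-j) h (by rwa [show -j + 1 = -(j - 1) by ring])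

lemma Chain.pair (C : Chain P β v) (i p q : ℤ) (hi : 3 ≤ v i) (hp : i ≤ p) (hq : p ≤ q)
    (hs : p + q ≤ 2 * i + 7) (h : ∀ x, i < x → x < q → v x = 2) :
    (Parts P (β p + β q)).ncard ≠ 6 := by
  obtain ⟨a, rfl⟩ : ∃ a : ℕ, p = i + a := ⟨(p - i).toNat, by omega⟩
  obtain ⟨b, rfl⟩ : ∃ b : ℕ, q = i + b := ⟨(q - i).toNat, by omega⟩
  have e1 := C.run_coord i a (fun x h1 h2 => h x h1 (by omega))
  have e2 := C.run_coord i b h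
  have e3 : β (i + a) + β (i + b) =
      lin (β i) (β (i + 1)) (2 - ((a + b : ℕ) : ℤ), ((a + b : ℕ) : ℤ)) := by
    rw [e1, e2, ← lin_add]
    congr 1
    ext <;> push_cast <;> simp <;> ring
  have hP := C.add _ _ (C.pos (i + a)) (C.pos (i + b))
  rw [e3] at hP ⊢
  rw [cnt_lin P _ _ (C.det i)]
  exact (C.loc i).uprun hi _ (by omega) (by omega) hP

lemma Chain.pairR (C : Chain P β v) (i p q : ℤ) (hi : 3 ≤ v i) (hp : p ≤ i) (hq : q ≤ p)
    (hs : 2 * i ≤ p + q + 7) (h : ∀ x, x < i → q < x → v x = 2) :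
    (Parts P (β p + β q)).ncard ≠ 6 := by
  have := C.rev.pair (-i) (-p) (-q) (by simpa using hi) (by omega) (by omega) (by omega)
    (fun x h1 h2 => h _ (by omega) (by omega))
  simpa using this

lemma Chain.bwd20 (C : Chain P β v) (N : NoPat v) (j : ℤ) :
    (Parts P (β j + β j)).ncard ≠ 6 := by
  have t := C.two
  by_cases h0 : 3 ≤ v j
  · exact C.pair j j j h0 le_rfl le_rfl (by omega) (fun x _ _ => by omega)
  have h0' : v j = 2 := by have := t j; omega
  by_cases h1 : 3 ≤ v (j - 1)
  · refine C.pair (j - 1) j j h1 (by omega) le_rfl (by omega) (fun x _ _ => by omega)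
  have h1' : v (j - 1) = 2 := by have := t (j - 1); omega
  by_cases h2 : 3 ≤ v (j + 1)
  · refine C.pairR (j + 1) j j h2 (by omega) le_rfl (by omega) (fun x _ _ => by omega)
  have h2' : v (j + 1) = 2 := by have := t (j + 1); omega
  by_cases h3 : 3 ≤ v (j - 2)
  · refine C.pair (j - 2) j j h3 (by omega) le_rfl (by omega) (fun x _ _ => ?_)
    obtain rfl : x = j - 1 := by omega
    assumption
  have h3' : v (j - 2) = 2 := by have := t (j - 2); omega
  by_cases h4 : 3 ≤ v (j + 2)
  · refine C.pairR (j + 2) j j h4 (by omega) le_rfl (by omega) (fun x _ _ => ?_)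
    obtain rfl : x = j + 1 := by omega
    assumption
  have h4' : v (j + 2) = 2 := by have := t (j + 2); omega
  by_cases h5 : 3 ≤ v (j - 3)
  · refine C.pair (j - 3) j j h5 (by omega) le_rfl (by omega) (fun x _ _ => ?_)
    obtain rfl | rfl : x = j - 1 ∨ x = j - 2 := by omega
    all_goals assumption
  have h5' : v (j - 3) = 2 := by have := t (j - 3); omega
  by_cases h6 : 3 ≤ v (j + 3)
  · refine C.pairR (j + 3) j j h6 (by omega) le_rfl (by omega) (fun x _ _ => ?_)
    obtain rfl | rfl : x = j + 1 ∨ x = j + 2 := by omega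
    all_goals assumption
  have h6' : v (j + 3) = 2 := by have := t (j + 3); omega
  exfalso
  apply N.run (j - 3)
  intro x _ _
  obtain rfl | rfl | rfl | rfl | rfl | rfl | rfl : x = j - 3 ∨ x = j - 2 ∨ x = j - 1 ∨ x = j ∨
    x = j + 1 ∨ x = j + 2 ∨ x = j + 3 := by omega
  all_goals assumption

lemma Chain.bwd11 (C : Chain P β v) (N : NoPat v) (j : ℤ) :
    (Parts P (β j + β (j + 1))).ncard ≠ 6 := by
  have t := C.two
  by_cases h0 : 3 ≤ v j
  · exact C.pair j j (j + 1) h0 le_rfl (by omega) (by omega) (fun x _ _ => by omega)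
  have h0' : v j = 2 := by have := t j; omega
  by_cases h2 : 3 ≤ v (j + 1)
  · rw [add_comm]
    refine C.pairR (j + 1) (j + 1) j h2 le_rfl (by omega) (by omega) (fun x _ _ => by omega)
  have h2' : v (j + 1) = 2 := by have := t (j + 1); omega
  by_cases h1 : 3 ≤ v (j - 1)
  · refine C.pair (j - 1) j (j + 1) h1 (by omega) (by omega) (by omega) (fun x _ _ => ?_)
    obtain rfl : x = j := by omega
    assumption
  have h1' : v (j - 1) = 2 := by have := t (j - 1); omega
  by_cases h4 : 3 ≤ v (j + 2)
  · rw [add_comm]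
    refine C.pairR (j + 2) (j + 1) j h4 (by omega) (by omega) (by omega) (fun x _ _ => ?_)
    obtain rfl : x = j + 1 := by omega
    assumption
  have h4' : v (j + 2) = 2 := by have := t (j + 2); omega
  by_cases h3 : 3 ≤ v (j - 2)
  · refine C.pair (j - 2) j (j + 1) h3 (by omega) (by omega) (by omega) (fun x _ _ => ?_)
    obtain rfl | rfl : x = j - 1 ∨ x = j := by omega
    all_goals assumption
  have h3' : v (j - 2) = 2 := by have := t (j - 2); omega
  by_cases h6 : 3 ≤ v (j + 3)
  · rw [add_comm]
    refine C.pairR (j + 3) (j + 1) j h6 (by omega) (by omega) (by omega) (fun x _ _ => ?_)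
    obtain rfl | rfl : x = j + 1 ∨ x = j + 2 := by omega
    all_goals assumption
  have h6' : v (j + 3) = 2 := by have := t (j + 3); omega
  by_cases h5 : 3 ≤ v (j - 3)
  · refine C.pair (j - 3) j (j + 1) h5 (by omega) (by omega) (by omega) (fun x _ _ => ?_)
    obtain rfl | rfl | rfl : x = j - 1 ∨ x = j - 2 ∨ x = j := by omega
    all_goals assumption
  have h5' : v (j - 3) = 2 := by have := t (j - 3); omega
  exfalso
  apply N.run (j - 3)
  intro x _ _
  obtain rfl | rfl | rfl | rfl | rfl | rfl | rfl : x = j - 3 ∨ x = j - 2 ∨ x = j - 1 ∨ x = j ∨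
    x = j + 1 ∨ x = j + 2 ∨ x = j + 3 := by omega
  all_goals assumption

lemma Chain.bwd30 (C : Chain P β v) (j : ℤ) (h : v j = 2) (h' : v (j + 1) = 2) :
    (Parts P (lin (β j) (β (j + 1)) (3, 0))).ncard ≠ 6 := by
  rw [cnt_lin P _ _ (C.det j)]
  have L := C.loc j
  rw [h, h'] at L
  exact L.low30

lemma Chain.bwd_half (C : Chain P β v) (N : NoPat v) (j e f : ℤ) (he : 1 ≤ e) (hf : 0 ≤ f)
    (hfe : f ≤ e) : (Parts P (lin (β j) (β (j + 1)) (e, f))).ncard ≠ 6 := by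
  have L := C.loc j
  have t := C.two
  have tj := t j
  have tj1 := t (j + 1)
  have tj2 := t (j - 1)
  have n4 := N.four j
  have D := C.det j
  by_cases hbig : 5 ≤ e ∨ (3 ≤ e ∧ 1 ≤ f) ∨ (2 ≤ e ∧ 2 ≤ f)
  · rw [cnt_lin P _ _ D]
    exact L.low50 e f (by omega) hf hbig
  obtain ⟨rfl, rfl⟩ | ⟨rfl, rfl⟩ | ⟨rfl, rfl⟩ | ⟨rfl, rfl⟩ | ⟨rfl, rfl⟩ | ⟨rfl, rfl⟩ :
    (e = 1 ∧ f = 0) ∨ (e = 2 ∧ f = 0) ∨ (e = 3 ∧ f = 0) ∨ (e = 4 ∧ f = 0) ∨ (e = 1 ∧ f = 1) ∨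
    (e = 2 ∧ f = 1) := by omega
  · rw [cnt_lin P _ _ D]
    exact L.up10
  · have := C.bwd20 N j
    rwa [show lin (β j) (β (j + 1)) (2, 0) = β j + β j by simp [lin, two_mul, two_smul]]
  · by_cases h3 : 3 ≤ v j
    · rw [cnt_lin P _ _ D]
      exact L.up30 h3
    have h2 : v j = 2 := by omega
    by_cases h4 : v (j + 1) = 2
    · exact C.bwd30 j h2 h4
    have h5 : v (j - 1) = 2 := by
      by_contra h5
      exact N.iso j h2 (by omega) (by omega)
    have := C.rev.bwd30 (-j) (by simpa using h2) (by rwa [show -(-j + 1) = j - 1 by ring])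
    simpa [lin] using this
  · rw [cnt_lin P _ _ D]
    by_cases h3 : v j ≤ 3
    · exact L.low40 h3
    · exact L.up40 (by omega)
  · have := C.bwd11 N j
    simpa [lin] using this
  · rw [cnt_lin P _ _ D]
    by_cases h3 : 3 ≤ v j
    · exact L.up21 h3
    have h2 : v j = 2 := by omega
    have h6 : ¬ 4 ≤ v (j + 1) := fun h => N.adj j h2 h
    by_cases h4 : v (j + 1) = 2
    · rw [h2, h4] at L
      exact L.low21a
    have h4' : v (j + 1) = 3 := by omega
    have h5 : v (j - 1) = 2 := by
      by_contra h5
      exact N.iso j h2 (by omega) (by omega)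
    rw [h2, h4'] at L
    apply L.low21b
    have e := C.prev (j - 1)
    have s := C.lin_shift j 3 (-2)
    rw [h2] at s
    rw [h5] at e
    norm_num at s
    show P (lin (β j) (β (j + 1)) (3, -2))
    rw [← s]
    have := C.pos (j - 1 - 1)
    rw [e] at this
    simpa using this

lemma Chain.bwd (C : Chain P β v) (N : NoPat v) (α : ℤ × ℤ) (hα : P α) :
    (Parts P α).ncard ≠ 6 := by
  obtain ⟨j, e, f, he, hf, rfl⟩ := C.cover α hα
  have h0 : 1 ≤ e + f := by
    by_contra h
    obtain ⟨rfl, rfl⟩ : e = 0 ∧ f = 0 := by omega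
    exact (C.loc j).zero hα
  rcases le_total f e with h | h
  · exact C.bwd_half N j e f (by omega) hf h
  · have := C.rev.bwd_half N.rev (-(j + 1)) f e (by omega) he h
    rw [lin_swap]
    rwa [show -(-(j + 1) + 1) = j by ring, neg_neg] at this

end
/-! ## Construction of the chain of indecomposables -/

/-- The trace of `ω_D`. -/
def trD (D : ℕ) : ℤ := if D % 4 = 1 then 1 else 0

lemma omega_add (D : ℕ) : omegaD D + omegaD' D = (trD D : ℝ) := by
  unfold omegaD omegaD' trD
  split_ifs
  · push_cast; ring
  · push_cast; ring

lemma omega'_neg (D : ℕ) (hD : 2 ≤ D) : omegaD' D < 0 := by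
  have h1 : (1 : ℝ) < Real.sqrt D := by
    rw [Real.lt_sqrt (by norm_num)]
    have : (2 : ℝ) ≤ D := by exact_mod_cast hD
    linarith
  unfold omegaD'
  split_ifs <;> linarith

lemma omega_gt (D : ℕ) (hD : 2 ≤ D) : 1 < omegaD D := by
  have h1 : (1 : ℝ) < Real.sqrt D := by
    rw [Real.lt_sqrt (by norm_num)]
    have : (2 : ℝ) ≤ D := by exact_mod_cast hD
    linarith
  unfold omegaD
  split_ifs <;> linarith

lemma emb1_add (D : ℕ) (a b : OK) : emb1 D (a + b) = emb1 D a + emb1 D b := by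
  simp [emb1]; ring
lemma emb2_add (D : ℕ) (a b : OK) : emb2 D (a + b) = emb2 D a + emb2 D b := by
  simp [emb2]; ring
lemma emb1_smul (D : ℕ) (n : ℤ) (a : OK) : emb1 D (n • a) = n * emb1 D a := by
  simp [emb1]; ring
lemma emb2_smul (D : ℕ) (n : ℤ) (a : OK) : emb2 D (n • a) = n * emb2 D a := by
  simp [emb2]; ring
lemma emb1_conj (D : ℕ) (a : OK) : emb1 D (conjOK D a) = emb2 D a := by
  have := omega_add D
  unfold trD at this
  simp only [emb1, emb2, conjOK]
  push_cast at this ⊢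
  linear_combination (-a.2 : ℝ) * this
lemma emb2_conj (D : ℕ) (a : OK) : emb2 D (conjOK D a) = emb1 D a := by
  have := omega_add D
  unfold trD at this
  simp only [emb1, emb2, conjOK]
  push_cast at this ⊢
  linear_combination (-a.2 : ℝ) * this

lemma conj_add (D : ℕ) (a b : OK) : conjOK D (a + b) = conjOK D a + conjOK D b := by
  simp only [conjOK]
  split_ifs <;> ext <;> simp <;> ring
lemma conj_smul (D : ℕ) (n : ℤ) (a : OK) : conjOK D (n • a) = n • conjOK D a := by
  simp only [conjOK]
  split_ifs <;> ext <;> simp <;> ring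
lemma det_conj (D : ℕ) (a b : OK) : det2 (conjOK D a) (conjOK D b) = - det2 a b := by
  simp only [conjOK, det2]; split_ifs <;> ring

lemma mkChain (D : ℕ) (β : ℤ → OK) (v : ℤ → ℤ) (pos : ∀ j, TotPos D (β j))
    (two : ∀ j, 2 ≤ v j)
    (rel : ∀ j, v j • β j = β (j - 1) + β (j + 1))
    (det : ∀ j, det2 (β j) (β (j + 1)) * det2 (β j) (β (j + 1)) = 1)
    (m1 : ∀ j, emb1 D (β j) < emb1 D (β (j + 1)))
    (m2 : ∀ j, emb2 D (β (j + 1)) < emb2 D (β j))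
    (hU : ∀ a b : ℝ, 0 < a → 0 < b → ∃ j, a * emb2 D (β j) < b * emb1 D (β j))
    (hL : ∀ a b : ℝ, 0 < a → 0 < b → ∃ j, b * emb1 D (β j) < a * emb2 D (β j)) :
    Chain (TotPos D) β v where
  add x y hx hy := by
    constructor
    · rw [emb1_add]; exact add_pos hx.1 hy.1
    · rw [emb2_add]; exact add_pos hx.2 hy.2
  zero h := by
    have := h.1
    simp [emb1] at this
  pos := pos
  two := two
  rel := rel
  det := det
  n1 j x y h hy := by
    have h1 := h.1
    simp only [lin, emb1_add, emb1_smul] at h1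
    have r := congrArg (emb1 D) (rel j)
    rw [emb1_add, emb1_smul] at r
    have m := m1 (j - 1)
    rw [sub_add_cancel] at m
    have p := (pos j).1
    have hy' : (y : ℝ) < 0 := by exact_mod_cast hy
    have key : 0 < ((x : ℝ) - (v j - 1) * (-y)) * emb1 D (β j) := by nlinarith
    have := (pos_iff_pos_of_mul_pos key).2 p
    have : (v j - 1) * (-y) < x := by
      have h : ((v j : ℝ) - 1) * (-y) < x := by linarith
      exact_mod_cast h
    omega
  n2 j x y h hx := by
    have h1 := h.2
    simp only [lin, emb2_add, emb2_smul] at h1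
    have r := congrArg (emb2 D) (rel (j + 1))
    rw [emb2_add, emb2_smul, add_sub_cancel_right] at r
    have m := m2 (j + 1)
    have p := (pos (j + 1)).2
    have hx' : (x : ℝ) < 0 := by exact_mod_cast hx
    have key : 0 < ((y : ℝ) - (v (j + 1) - 1) * (-x)) * emb2 D (β (j + 1)) := by nlinarith
    have := (pos_iff_pos_of_mul_pos key).2 p
    have : (v (j + 1) - 1) * (-x) < y := by
      have h : ((v (j + 1) : ℝ) - 1) * (-x) < y := by linarith
      exact_mod_cast h
    omega
  cover x hx := by
    have M1 : StrictMono (fun j => emb1 D (β j)) := strictMono_int_of_lt_succ m1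
    have M2 : StrictAnti (fun j => emb2 D (β j)) := strictAnti_int_of_succ_lt m2
    obtain ⟨j1, hj1⟩ := hU _ _ hx.1 hx.2
    obtain ⟨j0, hj0⟩ := hL _ _ hx.1 hx.2
    obtain ⟨j, hj, hmax⟩ := Int.exists_greatest_of_bdd
      (P := fun j => emb2 D x * emb1 D (β j) ≤ emb1 D x * emb2 D (β j))
      ⟨j1, by
        intro z hz
        by_contra hlt
        push Not at hlt
        have a1 := M1 hlt
        have a2 := M2 hlt
        simp only at a1 a2
        have := mul_lt_mul_of_pos_left a1 hx.2
        have := mul_lt_mul_of_pos_left a2 hx.1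
        linarith⟩ ⟨j0, hj0.le⟩
    have hj' : emb1 D x * emb2 D (β (j + 1)) < emb2 D x * emb1 D (β (j + 1)) := by
      by_contra h
      have := hmax (j + 1) (not_lt.1 h)
      omega
    obtain ⟨⟨e, f⟩, hq⟩ := lin_surj (β j) (β (j + 1)) (det j) x
    refine ⟨j, e, f, ?_, ?_, hq.symm⟩
    all_goals
      have q1 := congrArg (emb1 D) hq
      have q2 := congrArg (emb2 D) hq
      simp only [lin, emb1_add, emb1_smul, emb2_add, emb2_smul] at q1 q2
      have p1 := (pos j).1
      have p2 := (pos (j + 1)).2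
      have d : 0 < emb1 D (β (j + 1)) * emb2 D (β j) - emb1 D (β j) * emb2 D (β (j + 1)) := by
        have := mul_lt_mul_of_pos_left (m2 j) p1
        have := mul_lt_mul_of_pos_right (m1 j) (pos j).2
        linarith
      rw [← q1, ← q2] at hj hj'
    · have : 0 < (e : ℝ) *
          (emb1 D (β (j + 1)) * emb2 D (β j) - emb1 D (β j) * emb2 D (β (j + 1))) := by
        linarith
      have := (pos_iff_pos_of_mul_pos this).2 d
      exact_mod_cast this.le
    · have : 0 ≤ (f : ℝ) *
          (emb1 D (β (j + 1)) * emb2 D (β j) - emb1 D (β j) * emb2 D (β (j + 1))) := by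
        linarith
      have := nonneg_of_mul_nonneg_left this d
      exact_mod_cast this

/-- Shifted convergents: `cvg n = α_{n-1}`. -/
def cvg (D : ℕ) (u : ℕ → ℕ) : ℕ → OK
  | 0 => (1, 0)
  | 1 => (⌊omegaD D⌋ - trD D, 1)
  | n + 2 => (u (n + 1) : ℤ) • cvg D u (n + 1) + cvg D u n

lemma cvg_succ (D : ℕ) (u : ℕ → ℕ) (n : ℕ) :
    cvg D u (n + 2) = (u (n + 1) : ℤ) • cvg D u (n + 1) + cvg D u n := by rw [cvg]

/-- State `(k, r)` of the `j`-th indecomposable. -/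
def stt (u : ℕ → ℕ) : ℕ → ℕ × ℕ
  | 0 => (0, 0)
  | j + 1 => if (stt u j).2 + 1 < u (2 * (stt u j).1 + 1) then ((stt u j).1, (stt u j).2 + 1)
      else ((stt u j).1 + 1, 0)

/-- The `j`-th indecomposable, `j ≥ 0`. -/
def bN (D : ℕ) (u : ℕ → ℕ) (j : ℕ) : OK :=
  cvg D u (2 * (stt u j).1) + ((stt u j).2 : ℤ) • cvg D u (2 * (stt u j).1 + 1)

/-- The `j`-th coefficient, `j ≥ 0`. -/
def vN (u : ℕ → ℕ) (j : ℕ) : ℤ := if (stt u j).2 = 0 then (u (2 * (stt u j).1) : ℤ) + 2 else 2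

/-- two-sided sequence -/
def bZ (D : ℕ) (u : ℕ → ℕ) (j : ℤ) : OK :=
  if 0 ≤ j then bN D u j.toNat else conjOK D (bN D u (-j).toNat)

/-- two-sided coefficients -/
def vZ (u : ℕ → ℕ) (j : ℤ) : ℤ := vN u j.natAbs

lemma conj_b0 (D : ℕ) (u : ℕ → ℕ) : conjOK D (bN D u 0) = bN D u 0 := by
  simp [bN, stt, cvg, conjOK]

lemma bZ_nat (D : ℕ) (u : ℕ → ℕ) (n : ℕ) : bZ D u n = bN D u n := by
  simp [bZ]

lemma bZ_neg (D : ℕ) (u : ℕ → ℕ) (n : ℕ) : bZ D u (-(n : ℤ)) = conjOK D (bN D u n) := by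
  unfold bZ
  split_ifs with h
  · obtain rfl : n = 0 := by omega
    simp [conj_b0]
  · simp

section
variable {D : ℕ} {u : ℕ → ℕ} {γ : ℕ → ℝ}

lemma u_pos (hCF : CFData D u γ) (hD : 2 ≤ D) (i : ℕ) : 1 ≤ u i := by
  rcases Nat.eq_zero_or_pos i with rfl | hi
  · have h1 : (1 : ℤ) ≤ ⌊omegaD D⌋ := Int.le_floor.2 (by exact_mod_cast (omega_gt D hD).le)
    have := hCF.u_zero
    split_ifs at this <;> omega
  · have h1 : (1 : ℤ) ≤ ⌊γ i⌋ := Int.le_floor.2 (by exact_mod_cast (hCF.one_lt i hi).le)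
    have := hCF.floor_eq i hi
    omega

lemma stt_lt (hu : ∀ i, 1 ≤ u i) (j : ℕ) : (stt u j).2 < u (2 * (stt u j).1 + 1) := by
  induction j with
  | zero => have := hu 1; simp [stt]; omega
  | succ j ih =>
    rw [stt]
    split_ifs with h
    · exact h
    · have := hu (2 * ((stt u j).1 + 1) + 1)
      simp only; omega

lemma bN_succ (hu : ∀ i, 1 ≤ u i) (j : ℕ) :
    bN D u (j + 1) = bN D u j + cvg D u (2 * (stt u j).1 + 1) := by
  have := stt_lt hu j
  unfold bN
  rw [stt]
  split_ifs with h
  · push_cast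
    rw [add_smul, one_smul, add_assoc]
  · have e : u (2 * (stt u j).1 + 1) = (stt u j).2 + 1 := by omega
    simp only [Nat.cast_zero, zero_smul, add_zero]
    rw [show 2 * ((stt u j).1 + 1) = 2 * (stt u j).1 + 2 by ring, cvg, e]
    push_cast
    rw [add_smul, one_smul]
    abel

lemma bN_rel (hu : ∀ i, 1 ≤ u i) (j : ℕ) :
    vN u (j + 1) • bN D u (j + 1) = bN D u j + bN D u (j + 2) := by
  have h1 := bN_succ (D := D) hu j
  have h2 := bN_succ (D := D) hu (j + 1)
  rw [show j + 2 = j + 1 + 1 by ring, h2]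
  have h3 : bN D u j = bN D u (j + 1) - cvg D u (2 * (stt u j).1 + 1) := by rw [h1]; abel
  rw [h3]
  by_cases h : (stt u j).2 + 1 < u (2 * (stt u j).1 + 1)
  · have e : stt u (j + 1) = ((stt u j).1, (stt u j).2 + 1) := by rw [stt, if_pos h]
    have ev : vN u (j + 1) = 2 := by simp [vN, e]
    rw [ev, e, two_smul]
    abel
  · have e : stt u (j + 1) = ((stt u j).1 + 1, 0) := by rw [stt, if_neg h]
    have ev : vN u (j + 1) = u (2 * (stt u j).1 + 2) + 2 := by simp [vN, e]; ring_nf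
    have eb : bN D u (j + 1) = cvg D u (2 * (stt u j).1 + 2) := by
      simp [bN, e]; ring_nf
    rw [ev, eb, e]
    simp only
    rw [show 2 * ((stt u j).1 + 1) + 1 = 2 * (stt u j).1 + 1 + 2 by ring,
      cvg_succ D u (2 * (stt u j).1 + 1), add_smul, two_smul]
    rw [show 2 * (stt u j).1 + 1 + 1 = 2 * (stt u j).1 + 2 by ring]
    abel

lemma cvg_det (n : ℕ) : det2 (cvg D u n) (cvg D u (n + 1)) * det2 (cvg D u n) (cvg D u (n + 1)) = 1 := by
  induction n with
  | zero => simp [cvg, det2]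
  | succ n ih =>
    rw [← ih, cvg]
    simp only [det2, Prod.fst_add, Prod.snd_add, Prod.smul_fst, Prod.smul_snd, smul_eq_mul]
    ring

lemma bN_det (hu : ∀ i, 1 ≤ u i) (j : ℕ) :
    det2 (bN D u j) (bN D u (j + 1)) * det2 (bN D u j) (bN D u (j + 1)) = 1 := by
  rw [bN_succ hu, ← cvg_det (D := D) (u := u) (2 * (stt u j).1)]
  simp only [bN, det2, Prod.fst_add, Prod.snd_add, Prod.smul_fst, Prod.smul_snd, smul_eq_mul]
  ring

lemma cvg_emb1 (hD : 2 ≤ D) (n : ℕ) : 0 < emb1 D (cvg D u n) ∧ 0 < emb1 D (cvg D u (n + 1)) := by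
  induction n with
  | zero =>
    constructor
    · simp [cvg, emb1]
    · have h1 : (1 : ℤ) ≤ ⌊omegaD D⌋ := Int.le_floor.2 (by exact_mod_cast (omega_gt D hD).le)
      have h1' : (1 : ℝ) ≤ ⌊omegaD D⌋ := by exact_mod_cast h1
      have := omega'_neg D hD
      have := omega_add D
      simp only [cvg, emb1]
      push_cast
      linarith
  | succ n ih =>
    refine ⟨ih.2, ?_⟩
    rw [cvg, emb1_add, emb1_smul]
    have := ih.1
    have := ih.2
    positivity

lemma cvg_emb1_ge (hD : 2 ≤ D) (k : ℕ) : emb1 D (cvg D u 1) ≤ emb1 D (cvg D u (2 * k + 1)) := by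
  induction k with
  | zero => simp
  | succ k ih =>
    rw [show 2 * (k + 1) + 1 = 2 * k + 1 + 2 by ring,
      cvg_succ D u (2 * k + 1), emb1_add, emb1_smul]
    have h := (cvg_emb1 (u := u) hD (2 * k + 1)).2
    have : 0 ≤ ((u (2 * k + 1 + 1) : ℤ) : ℝ) * emb1 D (cvg D u (2 * k + 1 + 1)) := by positivity
    linarith

lemma cvg_emb2 (hCF : CFData D u γ) (n : ℕ) :
    emb2 D (cvg D u n) + γ (n + 1) * emb2 D (cvg D u (n + 1)) = 0 := by
  induction n with
  | zero =>
    have h := hCF.head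
    have h1 := hCF.one_lt 1 le_rfl
    have ho := omega_add D
    have e : emb2 D (cvg D u 1) = - (1 / γ 1) := by
      simp only [cvg, emb2]
      push_cast
      linarith
    have e0 : emb2 D (cvg D u 0) = 1 := by simp [cvg, emb2]
    rw [zero_add, e, e0]
    field_simp
    ring
  | succ n ih =>
    have h := hCF.step (n + 1) (by omega)
    have h1 := hCF.one_lt (n + 1 + 1) (by omega)
    rw [cvg, emb2_add, emb2_smul]
    have e : emb2 D (cvg D u n) = - γ (n + 1) * emb2 D (cvg D u (n + 1)) := by linarith
    rw [e, h]
    push_cast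
    field_simp
    ring

lemma cvg_sign (hCF : CFData D u γ) (k : ℕ) :
    0 < emb2 D (cvg D u (2 * k)) ∧ emb2 D (cvg D u (2 * k + 1)) < 0 := by
  induction k with
  | zero =>
    have h := cvg_emb2 hCF 0
    have h1 := hCF.one_lt 1 le_rfl
    have e0 : emb2 D (cvg D u 0) = 1 := by simp [cvg, emb2]
    refine ⟨by simp [e0], ?_⟩
    rw [e0] at h
    by_contra hc
    push Not at hc
    simp only [zero_add, mul_zero] at *
    nlinarith
  | succ k ih =>
    have h := cvg_emb2 hCF (2 * k + 1)
    have h' := cvg_emb2 hCF (2 * k + 2)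
    have h1 := hCF.one_lt (2 * k + 1 + 1) (by omega)
    have h1' := hCF.one_lt (2 * k + 2 + 1) (by omega)
    rw [show 2 * (k + 1) = 2 * k + 2 by ring]
    have a : 0 < emb2 D (cvg D u (2 * k + 2)) := by
      by_contra hc
      push Not at hc
      rw [show 2 * k + 1 + 1 = 2 * k + 2 by ring] at *
      nlinarith [ih.2]
    refine ⟨a, ?_⟩
    by_contra hc
    push Not at hc
    nlinarith

lemma bN_m1 (hCF : CFData D u γ) (hD : 2 ≤ D) (j : ℕ) :
    emb1 D (bN D u j) + emb1 D (cvg D u 1) ≤ emb1 D (bN D u (j + 1)) := by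
  rw [bN_succ (u_pos hCF hD), emb1_add]
  have := cvg_emb1_ge (u := u) hD (stt u j).1
  linarith

lemma bN_m2 (hCF : CFData D u γ) (hD : 2 ≤ D) (j : ℕ) :
    emb2 D (bN D u (j + 1)) < emb2 D (bN D u j) := by
  rw [bN_succ (u_pos hCF hD), emb2_add]
  have := (cvg_sign hCF (stt u j).1).2
  linarith

lemma bN_lin (hCF : CFData D u γ) (hD : 2 ≤ D) (j : ℕ) :
    1 + j * emb1 D (cvg D u 1) ≤ emb1 D (bN D u j) := by
  induction j with
  | zero => simp [bN, stt, cvg, emb1]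
  | succ j ih =>
    have := bN_m1 hCF hD j
    push_cast
    linarith

lemma bN_le (hCF : CFData D u γ) (hD : 2 ≤ D) (j : ℕ) : emb2 D (bN D u j) ≤ 1 := by
  induction j with
  | zero => simp [bN, stt, cvg, emb2]
  | succ j ih =>
    have := bN_m2 hCF hD j
    linarith

lemma bN_pos (hCF : CFData D u γ) (hD : 2 ≤ D) (j : ℕ) : TotPos D (bN D u j) := by
  constructor
  · have := bN_lin hCF hD j
    have := (cvg_emb1 (u := u) hD 0).2
    have : 0 ≤ (j : ℝ) * emb1 D (cvg D u 1) := by positivity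
    linarith
  · rw [bN, emb2_add, emb2_smul]
    have h1 := cvg_emb2 hCF (2 * (stt u j).1)
    have h2 := (cvg_sign hCF (stt u j).1).2
    have h3 := stt_lt (u_pos hCF hD) j
    have h4 := hCF.floor_eq (2 * (stt u j).1 + 1) (by omega)
    have h5 : ((⌊γ (2 * (stt u j).1 + 1)⌋ : ℤ) : ℝ) ≤ γ (2 * (stt u j).1 + 1) := Int.floor_le _
    rw [← h4] at h5
    have h6 : ((stt u j).2 : ℝ) < u (2 * (stt u j).1 + 1) := by exact_mod_cast h3
    push_cast at h5 ⊢
    nlinarith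

lemma vN_two (j : ℕ) : 2 ≤ vN u j := by
  unfold vN; split_ifs <;> omega

lemma bZ_unb (hCF : CFData D u γ) (hD : 2 ≤ D) (a b : ℝ) (ha : 0 < a) (hb : 0 < b) :
    ∃ n : ℕ, a * emb2 D (bN D u n) < b * emb1 D (bN D u n) := by
  have hc := (cvg_emb1 (u := u) hD 0).2
  obtain ⟨n, hn⟩ := exists_nat_gt (a / (b * emb1 D (cvg D u 1)))
  refine ⟨n, ?_⟩
  have h1 := bN_lin hCF hD n
  have h2 := bN_le hCF hD n
  have hbc : 0 < b * emb1 D (cvg D u 1) := by positivity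
  rw [div_lt_iff₀ hbc] at hn
  have := mul_le_mul_of_nonneg_left h1 hb.le
  have := mul_le_mul_of_nonneg_left h2 ha.le
  linarith

lemma bZ_chain (hCF : CFData D u γ) (hD : 2 ≤ D) : Chain (TotPos D) (bZ D u) (vZ u) := by
  have hu := u_pos hCF hD
  have hc := (cvg_emb1 (u := u) hD 0).2
  have cases : ∀ j : ℤ, (∃ n : ℕ, j = n) ∨ (∃ n : ℕ, j = -((n + 1 : ℕ) : ℤ)) := by
    intro j
    rcases le_or_gt 0 j with h | h
    · exact Or.inl ⟨j.toNat, by omega⟩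
    · exact Or.inr ⟨(-j - 1).toNat, by omega⟩
  have s1 : ∀ n : ℕ, bZ D u ((n : ℤ) + 1) = bN D u (n + 1) := fun n => by
    rw [← bZ_nat]; rfl
  have s2 : ∀ n : ℕ, bZ D u (-((n + 1 : ℕ) : ℤ) + 1) = conjOK D (bN D u n) := fun n => by
    rw [← bZ_neg]; congr 1; push_cast; ring
  have s3 : ∀ n : ℕ, bZ D u (-((n + 1 : ℕ) : ℤ) - 1) = conjOK D (bN D u (n + 2)) := fun n => by
    rw [← bZ_neg]; congr 1
  apply mkChain
  · intro j
    rcases cases j with ⟨n, rfl⟩ | ⟨n, rfl⟩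
    · rw [bZ_nat]; exact bN_pos hCF hD n
    · rw [bZ_neg]
      have := bN_pos hCF hD (n + 1)
      exact ⟨by rw [emb1_conj]; exact this.2, by rw [emb2_conj]; exact this.1⟩
  · intro j; exact vN_two _
  · intro j
    rcases cases j with ⟨n, rfl⟩ | ⟨n, rfl⟩
    · cases n with
      | zero =>
        have e1 : bZ D u (((0 : ℕ) : ℤ) - 1) = conjOK D (bN D u 1) := by
          rw [← bZ_neg]; rfl
        rw [e1, s1, bZ_nat, bN_succ hu]
        have hz := hCF.u_zero
        have hv : vZ u ((0 : ℕ) : ℤ) = u 0 + 2 := by simp [vZ, vN, stt]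
        rw [hv, hz]
        simp only [stt, bN, cvg, conjOK, trD]
        split_ifs <;> ext <;> simp <;> ring
      | succ n =>
        rw [s1, bZ_nat]
        have e1 : bZ D u (((n + 1 : ℕ) : ℤ) - 1) = bN D u n := by
          rw [← bZ_nat]; congr 1; push_cast; ring
        rw [e1]
        exact bN_rel hu n
    · rw [s2, s3, bZ_neg, ← conj_add, add_comm (bN D u (n + 2)) (bN D u n), ← bN_rel hu n, ← conj_smul]
      congr 2
  · intro j
    rcases cases j with ⟨n, rfl⟩ | ⟨n, rfl⟩
    · rw [s1, bZ_nat]; exact bN_det hu n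
    · rw [s2, bZ_neg, det_conj]
      have := bN_det (D := D) hu n
      rw [← this]
      simp only [det2]
      ring
  · intro j
    rcases cases j with ⟨n, rfl⟩ | ⟨n, rfl⟩
    · rw [s1, bZ_nat]
      have := bN_m1 hCF hD n
      linarith
    · rw [s2, bZ_neg, emb1_conj, emb1_conj]
      exact bN_m2 hCF hD n
  · intro j
    rcases cases j with ⟨n, rfl⟩ | ⟨n, rfl⟩
    · rw [s1, bZ_nat]
      exact bN_m2 hCF hD n
    · rw [s2, bZ_neg, emb2_conj, emb2_conj]
      have := bN_m1 hCF hD n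
      linarith
  · intro a b ha hb
    obtain ⟨n, hn⟩ := bZ_unb hCF hD a b ha hb
    exact ⟨n, by rw [bZ_nat]; exact hn⟩
  · intro a b ha hb
    obtain ⟨n, hn⟩ := bZ_unb hCF hD b a hb ha
    exact ⟨-(n : ℤ), by rw [bZ_neg, emb1_conj, emb2_conj]; exact hn⟩

/-! ## Translation between `u` and `v` -/

lemma stt_add {k r : ℕ} {j : ℕ} (h : stt u j = (k, r)) (i : ℕ) (hi : r + i < u (2 * k + 1)) :
    stt u (j + i) = (k, r + i) := by
  induction i with
  | zero => simpa using h
  | succ i ih =>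
    rw [← add_assoc, stt, ih (by omega), if_pos (by simpa [add_assoc] using hi)]
    simp [add_assoc]

lemma stt_end (hu : ∀ i, 1 ≤ u i) {k : ℕ} {j : ℕ} (h : stt u j = (k, 0)) :
    stt u (j + u (2 * k + 1)) = (k + 1, 0) := by
  have := hu (2 * k + 1)
  have e := stt_add h (u (2 * k + 1) - 1) (by omega)
  rw [show j + u (2 * k + 1) = j + (u (2 * k + 1) - 1) + 1 by omega, stt, e, if_neg]
  simp only; omega

lemma stt_ex (hu : ∀ i, 1 ≤ u i) (k : ℕ) : ∃ j, stt u j = (k, 0) := by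
  induction k with
  | zero => exact ⟨0, rfl⟩
  | succ k ih =>
    obtain ⟨j, hj⟩ := ih
    exact ⟨_, stt_end hu hj⟩

lemma vN_of {k r j : ℕ} (h : stt u j = (k, r)) :
    vN u j = if r = 0 then (u (2 * k) : ℤ) + 2 else 2 := by simp [vN, h]

lemma vZ_nat (n : ℕ) : vZ u n = vN u n := by simp [vZ]

lemma vZ_neg (j : ℤ) : vZ u (-j) = vZ u j := by simp [vZ]

lemma vZ_of_nonneg (j : ℤ) (h : 0 ≤ j) : ∃ n : ℕ, j = n ∧ vZ u j = vN u n :=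
  ⟨j.toNat, by omega, by rw [vZ]; congr 1; omega⟩

lemma fwd (hCF : CFData D u γ) (hD : 2 ≤ D)
    (h : (∃ i, 1 ≤ i ∧ Odd i ∧ 8 ≤ u i) ∨ (∃ i, u i = 2) ∨ (∃ i, 2 ≤ u i ∧ 2 ≤ u (i + 1))) :
    ∃ α, TotPos D α ∧ (Parts (TotPos D) α).ncard = 6 := by
  have C := bZ_chain hCF hD
  have hu := u_pos hCF hD
  rcases h with ⟨i, _, ⟨k, rfl⟩, h8⟩ | ⟨i, hi⟩ | ⟨i, h1, h2⟩
  · obtain ⟨j, hj⟩ := stt_ex hu k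
    apply C.fwdRun j
    · rw [vZ_nat, vN_of hj]
      have := hu (2 * k)
      simp; omega
    · intro x hx1 hx2
      obtain ⟨n, rfl⟩ : ∃ n : ℕ, x = ((j + n : ℕ) : ℤ) := ⟨(x - j).toNat, by omega⟩
      rw [vZ_nat, vN_of (stt_add hj n (by omega)), if_neg (by omega)]
  · rcases Nat.even_or_odd' i with ⟨k, rfl | rfl⟩
    · obtain ⟨j, hj⟩ := stt_ex hu k
      apply C.fwd4 j
      rw [vZ_nat, vN_of hj]
      simp [hi]
    · obtain ⟨j, hj⟩ := stt_ex hu k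
      have e1 := stt_add hj 1 (by omega)
      have e2 := stt_end hu hj
      rw [hi] at e2
      have := hu (2 * k)
      have := hu (2 * (k + 1))
      apply C.fwdIso (j + 1 : ℕ)
      · rw [vZ_nat, vN_of e1]; simp
      · rw [show ((j + 1 : ℕ) : ℤ) - 1 = j by push_cast; ring, vZ_nat, vN_of hj]
        simp; omega
      · rw [show ((j + 1 : ℕ) : ℤ) + 1 = (j + 2 : ℕ) by push_cast; ring, vZ_nat, vN_of e2]
        simp; omega
  · rcases Nat.even_or_odd' i with ⟨k, rfl | rfl⟩
    · obtain ⟨j, hj⟩ := stt_ex hu k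
      have e1 := stt_add hj 1 (by omega)
      apply C.fwdAdj' (j + 1 : ℕ)
      · rw [vZ_nat, vN_of e1]; simp
      · rw [show ((j + 1 : ℕ) : ℤ) - 1 = j by push_cast; ring, vZ_nat, vN_of hj]
        simp; omega
    · obtain ⟨j, hj⟩ := stt_ex hu k
      have e1 := stt_add hj (u (2 * k + 1) - 1) (by omega)
      have e2 := stt_end hu hj
      apply C.fwdAdj (j + (u (2 * k + 1) - 1) : ℕ)
      · rw [vZ_nat, vN_of e1, if_neg (by omega)]
      · rw [show ((j + (u (2 * k + 1) - 1) : ℕ) : ℤ) + 1 = (j + u (2 * k + 1) : ℕ) by omega,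
          vZ_nat, vN_of e2, show 2 * (k + 1) = 2 * k + 1 + 1 by ring]
        simp; omega

/-- Step of the state machine in terms of `v`. -/
lemma step_two (hu : ∀ i, 1 ≤ u i) (j : ℕ) (h : vN u (j + 1) = 2) :
    stt u (j + 1) = ((stt u j).1, (stt u j).2 + 1) ∧ (stt u j).2 + 1 < u (2 * (stt u j).1 + 1) := by
  by_cases h' : (stt u j).2 + 1 < u (2 * (stt u j).1 + 1)
  · exact ⟨by rw [stt, if_pos h'], h'⟩
  · have e : stt u (j + 1) = ((stt u j).1 + 1, 0) := by rw [stt, if_neg h']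
    rw [vN_of e] at h
    have := hu (2 * ((stt u j).1 + 1))
    simp at h
    omega

lemma step_three (j : ℕ) (h : 3 ≤ vN u (j + 1)) :
    stt u (j + 1) = ((stt u j).1 + 1, 0) ∧ ¬ (stt u j).2 + 1 < u (2 * (stt u j).1 + 1) := by
  by_cases h' : (stt u j).2 + 1 < u (2 * (stt u j).1 + 1)
  · have e : stt u (j + 1) = ((stt u j).1, (stt u j).2 + 1) := by rw [stt, if_pos h']
    rw [vN_of e] at h
    simp at h
  · exact ⟨by rw [stt, if_neg h'], h'⟩

lemma three_zero (j : ℕ) (h : 3 ≤ vN u j) : (stt u j).2 = 0 := by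
  by_contra h'
  simp [vN, h'] at h

lemma nopat (hCF : CFData D u γ) (hD : 2 ≤ D)
    (h1 : ¬ ∃ i, 1 ≤ i ∧ Odd i ∧ 8 ≤ u i) (h2 : ¬ ∃ i, u i = 2)
    (h3 : ¬ ∃ i, 2 ≤ u i ∧ 2 ≤ u (i + 1)) : NoPat (vZ u) := by
  have hu := u_pos hCF hD
  have hv0 : 3 ≤ vN u 0 := by
    have := hu 0
    simp [vN, stt]; omega
  have runN : ∀ j : ℕ, ¬ (∀ i : ℕ, i ≤ 6 → vN u (j + 1 + i) = 2) := by
    intro j h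
    have s : ∀ i : ℕ, i ≤ 6 → stt u (j + 1 + i) = ((stt u j).1, (stt u j).2 + 1 + i) ∧
        (stt u j).2 + 1 + i < u (2 * (stt u j).1 + 1) := by
      intro i
      induction i with
      | zero => intro _; exact step_two hu j (h 0 (by omega))
      | succ i ih =>
        intro hi
        obtain ⟨a, b⟩ := ih (by omega)
        have := step_two hu (j + 1 + i) (h (i + 1) hi)
        rw [a] at this
        exact this
    have := (s 6 le_rfl).2
    exact h1 ⟨2 * (stt u j).1 + 1, by omega, ⟨_, rfl⟩, by omega⟩
  have isoN : ∀ j : ℕ, vN u (j + 1) = 2 → 3 ≤ vN u j → 3 ≤ vN u (j + 2) → False := by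
    intro j a b c
    have s := step_two hu j a
    have z := three_zero j b
    have t := (step_three (j + 1) c).2
    rw [s.1] at t
    have t' := s.2
    simp only at t
    exact h2 ⟨2 * (stt u j).1 + 1, by omega⟩
  have adjN : ∀ j : ℕ, vN u (j + 1) = 2 → 4 ≤ vN u (j + 2) → False := by
    intro j a c
    have s := step_two hu j a
    have c' : 3 ≤ vN u (j + 1 + 1) := le_trans (by norm_num) c
    have t := (step_three (u := u) (j + 1) c').1
    rw [vN_of t, s.1] at c
    simp at c
    refine h3 ⟨2 * (stt u j).1 + 1, by omega, ?_⟩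
    rw [show 2 * (stt u j).1 + 1 + 1 = 2 * ((stt u j).1 + 1) by ring]
    omega
  have adjN' : ∀ j : ℕ, vN u (j + 1) = 2 → 4 ≤ vN u j → False := by
    intro j a c
    have s := step_two hu j a
    have z := three_zero (u := u) j (by omega)
    simp [vN, z] at c
    exact h3 ⟨2 * (stt u j).1, by omega, by omega⟩
  have z0 : vZ u 0 = vN u 0 := rfl
  have cases : ∀ j : ℤ, vZ u j = 2 →
      (∃ n : ℕ, j = ((n + 1 : ℕ) : ℤ)) ∨ (∃ n : ℕ, j = -((n + 1 : ℕ) : ℤ)) := by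
    intro j hj
    rcases lt_trichotomy j 0 with h | rfl | h
    · exact Or.inr ⟨(-j - 1).toNat, by omega⟩
    · omega
    · exact Or.inl ⟨(j - 1).toNat, by omega⟩
  have p1 : ∀ n : ℕ, vZ u (((n + 1 : ℕ) : ℤ) + 1) = vN u (n + 2) := fun n => by
    rw [← vZ_nat]; rfl
  have p2 : ∀ n : ℕ, vZ u (((n + 1 : ℕ) : ℤ) - 1) = vN u n := fun n => by
    rw [← vZ_nat]; congr 1; push_cast; ring
  have p3 : ∀ n : ℕ, vZ u (-((n + 1 : ℕ) : ℤ) + 1) = vN u n := fun n => by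
    rw [← vZ_nat, ← vZ_neg]; congr 1; push_cast; ring
  have p4 : ∀ n : ℕ, vZ u (-((n + 1 : ℕ) : ℤ) - 1) = vN u (n + 2) := fun n => by
    rw [← vZ_nat, ← vZ_neg]; congr 1
  constructor
  · intro j h
    have hne : ¬ (j ≤ 0 ∧ 0 ≤ j + 6) := by
      rintro ⟨a, b⟩
      have := h 0 a b
      omega
    by_cases hj : 0 < j
    · apply runN (j - 1).toNat
      intro i hi
      rw [← vZ_nat]
      exact h _ (by omega) (by omega)
    · apply runN (-(j + 6) - 1).toNat
      intro i hi
      rw [← vZ_nat, ← vZ_neg]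
      exact h _ (by omega) (by omega)
  · intro j hj
    rw [vZ, vN] at hj
    split_ifs at hj
    · exact h2 ⟨_, by exact_mod_cast (by omega : (u (2 * (stt u j.natAbs).1) : ℤ) = 2)⟩
    · omega
  · intro j a b c
    rcases cases j a with ⟨n, rfl⟩ | ⟨n, rfl⟩
    · rw [p1] at c; rw [p2] at b; rw [vZ_nat] at a
      exact isoN n a b c
    · rw [p3] at c; rw [p4] at b; rw [vZ_neg, vZ_nat] at a
      exact isoN n a c b
  · intro j a b
    rcases cases j a with ⟨n, rfl⟩ | ⟨n, rfl⟩
    · rw [p1] at b; rw [vZ_nat] at a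
      exact adjN n a b
    · rw [p3] at b; rw [vZ_neg, vZ_nat] at a
      exact adjN' n a b
  · intro j a b
    rcases cases j a with ⟨n, rfl⟩ | ⟨n, rfl⟩
    · rw [p2] at b; rw [vZ_nat] at a
      exact adjN' n a b
    · rw [p4] at b; rw [vZ_neg, vZ_nat] at a
      exact adjN n a b

end

/-- `6 ∈ p_K(O_K^+)` iff one of the three continued-fraction
conditions holds. -/
theorem stmt17 (D : ℕ) (hD : 2 ≤ D) (hsq : Squarefree D)
    (u : ℕ → ℕ) (γ : ℕ → ℝ) (hCF : CFData D u γ) :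
    (∃ α : OK, TotPos D α ∧ pK D α = 6) ↔
      ((∃ i, 1 ≤ i ∧ Odd i ∧ 8 ≤ u i) ∨
       (∃ i, u i = 2) ∨
       (∃ i, 2 ≤ u i ∧ 2 ≤ u (i + 1))) := by
  constructor
  · rintro ⟨α, hα, h6⟩
    by_contra hcon
    rw [not_or, not_or] at hcon
    exact (bZ_chain hCF hD).bwd (nopat hCF hD hcon.1 hcon.2.1 hcon.2.2) α hα h6
  · intro h
    exact fwd hCF hD h
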